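/- arXiv:2409.03740 — 2 statements merged into one kernel-verified Lean document; each statement's English description precedes it below -/
import Mathlib

section
/- Let λ > 0, μ > 0 and for each β > 0 let T and W be independent random variables with T ~ Exp(λ) and W ~ Exp(μ), and set X_β = −(2β/μ) · W · e^{−β(T+W)} / (e^{−βT} + e^{−βW})². Then lim_{β→∞} β² · ( E[X_β] + 2λ/(λ+μ)² ) = π² λ (μ² − λ² + 2μλ) / (6(λ+μ)²); that is, the bias of the smoothed pathwise one-step gradient estimator relative to the true one-step gradient −2λ/(λ+μ)² equals β^{−2} · π² λ (μ² − λ² + 2μλ)/(6(λ+μ)²) + o(β^{−2}) as β → ∞. -/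
open MeasureTheory Real Filter Set

section SoftminBias

lemma integrableOn_pow_mul_exp_neg_mul (n : ℕ) {b : ℝ} (hb : 0 < b) :
    IntegrableOn (fun x : ℝ => x ^ n * Real.exp (-(b * x))) (Ioi 0) := by
  have h := integrableOn_rpow_mul_exp_neg_mul_rpow (p := 1) (s := n) (b := b)
    (by have : (0 : ℝ) ≤ n := n.cast_nonneg
        linarith) one_pos hb
  refine h.congr_fun (fun x _ => ?_) measurableSet_Ioi
  simp

lemma integral_pow_mul_exp_neg_mul (n : ℕ) {b : ℝ} (hb : 0 < b) :
    ∫ x in Ioi (0 : ℝ), x ^ n * Real.exp (-(b * x)) = n.factorial / b ^ (n + 1) := by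
  have h := Real.integral_rpow_mul_exp_neg_mul_Ioi (a := (n : ℝ) + 1) (r := b)
    (by positivity) hb
  rw [Real.Gamma_nat_eq_factorial] at h
  have e : ((n : ℝ) + 1) = ((n + 1 : ℕ) : ℝ) := by push_cast; ring
  rw [add_sub_cancel_right, e, Real.rpow_natCast] at h
  simp only [Real.rpow_natCast] at h
  rw [h, one_div, inv_pow]
  ring

/-- The standard logistic density. -/
noncomputable def logisticDensity (v : ℝ) : ℝ := Real.exp (-v) / (1 + Real.exp (-v)) ^ 2

lemma logisticDensity_nonneg (v : ℝ) : 0 ≤ logisticDensity v := by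
  unfold logisticDensity; positivity

lemma logisticDensity_le_exp_neg (v : ℝ) : logisticDensity v ≤ Real.exp (-v) := by
  have h := Real.exp_pos (-v)
  exact div_le_self h.le (by nlinarith)

lemma logisticDensity_le_one (v : ℝ) : logisticDensity v ≤ 1 := by
  have h := Real.exp_pos (-v)
  unfold logisticDensity
  rw [div_le_one (by positivity)]
  nlinarith

lemma continuous_logisticDensity : Continuous logisticDensity := by
  unfold logisticDensity
  refine Continuous.div (by fun_prop) (by fun_prop) fun v => by positivity

lemma logisticDensity_neg (v : ℝ) : logisticDensity (-v) = logisticDensity v := by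
  have h : Real.exp v * Real.exp (-v) = 1 := by rw [← Real.exp_add]; simp
  have := Real.exp_pos v
  have := Real.exp_pos (-v)
  unfold logisticDensity
  rw [neg_neg, div_eq_div_iff (by positivity) (by positivity)]
  linear_combination (Real.exp (-v) - Real.exp v) * h

lemma exp_neg_mul_div_sq_eq_logisticDensity (β t w : ℝ) :
    Real.exp (-(β * (t + w))) / (Real.exp (-(β * t)) + Real.exp (-(β * w))) ^ 2 =
      logisticDensity (β * (t - w)) := by
  have e1 : Real.exp (-(β * (t + w))) = Real.exp (-(β * t)) * Real.exp (-(β * w)) := by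
    rw [← Real.exp_add]; ring_nf
  have e2 : Real.exp (-(β * (t - w))) = Real.exp (-(β * t)) / Real.exp (-(β * w)) := by
    rw [← Real.exp_sub]; ring_nf
  have := Real.exp_pos (-(β * t))
  have := Real.exp_pos (-(β * w))
  unfold logisticDensity
  rw [e1, e2]
  field_simp
  ring

lemma integrableOn_logisticDensity_mul_pow (n : ℕ) :
    IntegrableOn (fun v => logisticDensity v * v ^ n) (Ioi 0) := by
  refine (integrableOn_pow_mul_exp_neg_mul n one_pos).mono'
    (continuous_logisticDensity.mul (continuous_pow n)).aestronglyMeasurable ?_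
  filter_upwards [ae_restrict_mem measurableSet_Ioi] with v hv
  have hv : (0 : ℝ) < v := hv
  rw [Real.norm_eq_abs, abs_of_nonneg (mul_nonneg (logisticDensity_nonneg v) (by positivity)),
    mul_comm, one_mul]
  gcongr
  exact logisticDensity_le_exp_neg v

lemma integral_logisticDensity : ∫ v in Ioi (0 : ℝ), logisticDensity v = 1 / 2 := by
  have hd : ∀ x : ℝ, HasDerivAt (fun v => (1 + Real.exp (-v))⁻¹) (logisticDensity x) x := by
    intro x
    have h := (((hasDerivAt_neg x).exp).const_add 1).inv (by positivity)
    refine h.congr_deriv ?_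
    simp [logisticDensity]
  have hl : Tendsto (fun v : ℝ => (1 + Real.exp (-v))⁻¹) atTop (nhds (1 + 0)⁻¹) :=
    ((Real.tendsto_exp_neg_atTop_nhds_zero).const_add 1).inv₀ (by norm_num)
  rw [integral_Ioi_of_hasDerivAt_of_nonneg (hd 0).continuousAt.continuousWithinAt
    (fun x _ => hd x) (fun x _ => logisticDensity_nonneg x) hl]
  norm_num

lemma hasSum_iff_of_forall_eq {f g : ℕ → ℝ} {a : ℝ} (h : ∀ n, f n = g n) :
    HasSum f a ↔ HasSum g a := by
  rw [funext h]

lemma hasSum_alternating_inv_sq :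
    HasSum (fun n : ℕ => (-1 : ℝ) ^ (n + 1) * (1 / (n : ℝ) ^ 2)) (π ^ 2 / 12) := by
  have hz := hasSum_zeta_two
  have he : HasSum (fun k : ℕ => 1 / ((2 * k : ℕ) : ℝ) ^ 2) (π ^ 2 / 24) := by
    have h := hz.mul_left (1 / 4)
    rw [show 1 / 4 * (π ^ 2 / 6) = π ^ 2 / 24 by ring] at h
    exact (hasSum_iff_of_forall_eq fun k => by push_cast; ring).2 h
  have ho' := (hz.summable.comp_injective
    (i := fun k : ℕ => 2 * k + 1) (fun a b h => by simpa using h)).hasSum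
  have ho : HasSum (fun k : ℕ => 1 / ((2 * k + 1 : ℕ) : ℝ) ^ 2) (π ^ 2 / 8) := by
    have h := (HasSum.even_add_odd (f := fun n : ℕ => 1 / (n : ℝ) ^ 2) he ho').unique hz
    exact (show _ = π ^ 2 / 8 from eq_sub_of_add_eq' h |>.trans (by ring)) ▸ ho'
  rw [show π ^ 2 / 12 = -(π ^ 2 / 24) + π ^ 2 / 8 by ring]
  refine HasSum.even_add_odd ((hasSum_iff_of_forall_eq fun k => ?_).2 he.neg)
    ((hasSum_iff_of_forall_eq fun k => ?_).2 ho)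
  · rw [pow_succ, pow_mul]; simp
  · rw [pow_succ, pow_succ, pow_mul]; simp

lemma integral_logisticDensity_mul_sq :
    ∫ v in Ioi (0 : ℝ), logisticDensity v * v ^ 2 = π ^ 2 / 6 := by
  set F : ℕ → ℝ → ℝ := fun n v =>
    ((-1 : ℝ) ^ (n + 1) * n) * (v ^ 2 * Real.exp (-(n * v))) with hF
  have hint : ∀ n, Integrable (F n) (volume.restrict (Ioi 0)) := by
    intro n
    rcases Nat.eq_zero_or_pos n with rfl | hn
    · simp [hF]
    · exact (integrableOn_pow_mul_exp_neg_mul 2 (by exact_mod_cast hn)).const_mul _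
  have hval : ∀ n : ℕ, (n : ℝ) * ∫ v in Ioi (0 : ℝ), v ^ 2 * Real.exp (-(n * v)) =
      2 * (1 / (n : ℝ) ^ 2) := by
    intro n
    rcases Nat.eq_zero_or_pos n with rfl | hn
    · simp
    · have hn' : (0 : ℝ) < n := by exact_mod_cast hn
      rw [integral_pow_mul_exp_neg_mul 2 hn']
      simp only [Nat.factorial]
      push_cast
      field_simp
  have hnorm : ∀ n, ∫ v in Ioi (0 : ℝ), ‖F n v‖ = 2 * (1 / (n : ℝ) ^ 2) := by
    intro n
    rw [← hval n, ← integral_const_mul]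
    refine integral_congr_ae (Eventually.of_forall fun v => ?_)
    simp [hF]
  have hs := hasSum_integral_of_summable_integral_norm hint
    (by simp_rw [hnorm]; exact hasSum_zeta_two.summable.mul_left 2)
  have hs2 : HasSum (fun n => ∫ v in Ioi (0 : ℝ), F n v) (π ^ 2 / 6) := by
    rw [show π ^ 2 / 6 = 2 * (π ^ 2 / 12) by ring]
    refine (hasSum_iff_of_forall_eq fun n => ?_).2 (hasSum_alternating_inv_sq.mul_left 2)
    rw [integral_const_mul, mul_assoc, hval]
    ring
  rw [← hs.unique hs2]
  refine setIntegral_congr_fun measurableSet_Ioi fun v hv => ?_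
  have hv : (0 : ℝ) < v := hv
  have hg := hasSum_coe_mul_geometric_of_norm_lt_one (r := -Real.exp (-v))
    (by simpa [abs_of_pos (Real.exp_pos _)] using hv)
  have hg' : HasSum (fun n => F n v) (logisticDensity v * v ^ 2) := by
    have e : logisticDensity v * v ^ 2 =
        -v ^ 2 * (-Real.exp (-v) / (1 - -Real.exp (-v)) ^ 2) := by
      rw [logisticDensity, sub_neg_eq_add]
      ring
    rw [e]
    refine (hasSum_iff_of_forall_eq fun n => ?_).2 (hg.mul_left (-v ^ 2))
    have : Real.exp (-(n * v)) = Real.exp (-v) ^ n := by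
      rw [← Real.exp_nat_mul]; ring_nf
    simp only [hF]
    rw [this, neg_pow (Real.exp (-v)), pow_succ]
    ring
  exact hg'.tsum_eq.symm

lemma exp_neg_le_quadratic {x : ℝ} (hx : 0 ≤ x) : Real.exp (-x) ≤ 1 - x + x ^ 2 / 2 := by
  have h := Real.quadratic_le_exp_of_nonneg hx
  have hp := Real.exp_pos (-x)
  have h1 : Real.exp x * Real.exp (-x) = 1 := by rw [← Real.exp_add]; simp
  have hq : 0 ≤ 1 - x + x ^ 2 / 2 := by nlinarith [sq_nonneg (x - 1)]
  have h2 : 1 ≤ (1 - x + x ^ 2 / 2) * Real.exp x := by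
    nlinarith [mul_le_mul_of_nonneg_left h hq, sq_nonneg (x ^ 2)]
  nlinarith [mul_le_mul_of_nonneg_right h2 hp.le]

lemma abs_exp_neg_sub_quadratic_le {x : ℝ} (hx : 0 ≤ x) :
    |Real.exp (-x) - (1 - x + x ^ 2 / 2)| ≤ x ^ 3 := by
  have hup := exp_neg_le_quadratic hx
  have hx3 : 0 ≤ x ^ 3 := by positivity
  rw [abs_le]
  refine ⟨?_, by linarith⟩
  rcases le_or_gt x 1 with h1 | h1
  · have h := Real.exp_bound (x := -x) (by rwa [abs_neg, abs_of_nonneg hx]) (n := 3) (by norm_num)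
    rw [abs_neg, abs_of_nonneg hx, abs_le] at h
    norm_num [Finset.sum_range_succ, Nat.factorial] at h
    linarith [h.1]
  · nlinarith [Real.exp_pos (-x), mul_pos (sub_pos.2 h1) (sub_pos.2 h1), sq_nonneg x,
      mul_nonneg (sq_nonneg x) (sub_pos.2 h1).le]

/-- The two-sided density at `|t - w| = a` of the weight `w e^{-λt-μw}` on the quadrant. -/
noncomputable def gapWeight (lam mu a : ℝ) : ℝ :=
  Real.exp (-(lam * a)) / (lam + mu) ^ 2 +
    Real.exp (-(mu * a)) * (1 / (lam + mu) ^ 2 + a / (lam + mu))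

lemma abs_gapWeight_sub_le {lam mu a : ℝ} (hlam : 0 < lam) (hmu : 0 < mu) (ha : 0 ≤ a) :
    |gapWeight lam mu a - 2 / (lam + mu) ^ 2 -
        ((lam ^ 2 + mu ^ 2) / (2 * (lam + mu) ^ 2) - mu / (lam + mu)) * a ^ 2| ≤
      ((lam ^ 3 + mu ^ 3) / (lam + mu) ^ 2 + mu ^ 2 / (2 * (lam + mu))) * a ^ 3 := by
  have h1 := abs_le.1 (abs_exp_neg_sub_quadratic_le (mul_nonneg hlam.le ha))
  have h2 := abs_le.1 (abs_exp_neg_sub_quadratic_le (mul_nonneg hmu.le ha))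
  have h3 := exp_neg_le_quadratic (mul_nonneg hmu.le ha)
  have h4 := Real.one_sub_le_exp_neg (mu * a)
  have hs : 0 < lam + mu := by positivity
  unfold gapWeight
  set A := Real.exp (-(lam * a))
  set B := Real.exp (-(mu * a))
  have e : A / (lam + mu) ^ 2 + B * (1 / (lam + mu) ^ 2 + a / (lam + mu)) - 2 / (lam + mu) ^ 2 -
        ((lam ^ 2 + mu ^ 2) / (2 * (lam + mu) ^ 2) - mu / (lam + mu)) * a ^ 2 =
      (1 / (lam + mu) ^ 2) * ((A - (1 - lam * a + (lam * a) ^ 2 / 2)) +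
        (B - (1 - mu * a + (mu * a) ^ 2 / 2))) + (a / (lam + mu)) * (B - (1 - mu * a)) := by
    field_simp
    ring
  have e2 : ((lam ^ 3 + mu ^ 3) / (lam + mu) ^ 2 + mu ^ 2 / (2 * (lam + mu))) * a ^ 3 =
      (1 / (lam + mu) ^ 2) * ((lam * a) ^ 3 + (mu * a) ^ 3) +
        (a / (lam + mu)) * ((mu * a) ^ 2 / 2) := by
    field_simp
  rw [e, e2]
  refine (abs_add_le _ _).trans (add_le_add ?_ ?_)
  · rw [abs_mul, abs_of_pos (by positivity : 0 < 1 / (lam + mu) ^ 2)]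
    gcongr
    rw [abs_le]
    constructor <;> linarith
  · rw [abs_mul, abs_of_nonneg (by positivity : 0 ≤ a / (lam + mu))]
    gcongr
    rw [abs_le]
    constructor <;> nlinarith [sq_nonneg (mu * a)]

/-- Changing variables to the difference in an integral against a product weight. -/
lemma integral_integral_comp_sub_mul {φ a b : ℝ → ℝ} {C : ℝ} (hφ : Continuous φ)
    (hC : ∀ u, ‖φ u‖ ≤ C) (ha : Integrable a) (hb : Integrable b) :
    Integrable (fun u => φ u * ∫ w, a (u + w) * b w) ∧
      ∫ t, ∫ w, φ (t - w) * (a t * b w) = ∫ u, φ u * ∫ w, a (u + w) * b w := by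
  have hf : Integrable (fun z : ℝ × ℝ => φ (z.1 - z.2) * (a z.1 * b z.2))
      (volume.prod volume) :=
    (ha.mul_prod hb).bdd_mul (hφ.comp (by fun_prop)).aestronglyMeasurable
      (Eventually.of_forall fun _ => hC _)
  have hg : Integrable (fun z : ℝ × ℝ => φ z.1 * (a (z.1 + z.2) * b z.2))
      (volume.prod volume) := by
    have := (measurePreserving_add_prod (volume : Measure ℝ)
      (volume : Measure ℝ)).integrable_comp_of_integrable hf
    refine this.congr (Eventually.of_forall fun z => ?_)
    simp
  have hg1 := hg.integral_prod_left
  simp only [integral_const_mul] at hg1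
  refine ⟨hg1, ?_⟩
  rw [integral_integral_swap hf]
  have : ∀ w, ∫ t, φ (t - w) * (a t * b w) = ∫ u, φ u * (a (u + w) * b w) := by
    intro w
    rw [← integral_add_right_eq_self _ w]
    simp
  simp_rw [this]
  rw [← integral_integral_swap (f := fun u w => φ u * (a (u + w) * b w)) hg]
  simp_rw [integral_const_mul]

lemma integral_eq_integral_Ioi_add_neg {f : ℝ → ℝ} (hf : Integrable f) :
    ∫ u, f u = ∫ u in Ioi (0 : ℝ), (f u + f (-u)) := by
  rw [integral_add hf.integrableOn hf.comp_neg.integrableOn, integral_comp_neg_Ioi, neg_zero,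
    ← setIntegral_univ, ← Ioi_union_Iic (a := (0 : ℝ)),
    setIntegral_union (by simp [disjoint_left]) measurableSet_Iic hf.integrableOn hf.integrableOn]

lemma integral_gap_of_nonneg {lam mu u : ℝ} (hlam : 0 < lam) (hmu : 0 < mu) (hu : 0 ≤ u) :
    ∫ w, (Ioi (0 : ℝ)).indicator (fun t => Real.exp (-(lam * t))) (u + w) *
        (Ioi (0 : ℝ)).indicator (fun w => w * Real.exp (-(mu * w))) w =
      Real.exp (-(lam * u)) / (lam + mu) ^ 2 := by
  have hs : 0 < lam + mu := by positivity
  have h := integral_pow_mul_exp_neg_mul 1 hs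
  have : ∀ w, (Ioi (0 : ℝ)).indicator (fun t => Real.exp (-(lam * t))) (u + w) *
        (Ioi (0 : ℝ)).indicator (fun w => w * Real.exp (-(mu * w))) w =
      (Ioi (0 : ℝ)).indicator (fun w => Real.exp (-(lam * u)) *
        (w ^ 1 * Real.exp (-((lam + mu) * w)))) w := by
    intro w
    by_cases hw : 0 < w
    · have huw : 0 < u + w := by positivity
      simp only [indicator, mem_Ioi, hw, huw, if_true]
      rw [pow_one, mul_left_comm, mul_left_comm _ w, ← Real.exp_add, ← Real.exp_add]
      ring_nf
    · simp [indicator, hw]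
  simp_rw [this]
  rw [integral_indicator measurableSet_Ioi, integral_const_mul, h]
  simp [div_eq_mul_inv]

lemma integral_gap_neg {lam mu u : ℝ} (hlam : 0 < lam) (hmu : 0 < mu) (hu : 0 ≤ u) :
    ∫ w, (Ioi (0 : ℝ)).indicator (fun t => Real.exp (-(lam * t))) (-u + w) *
        (Ioi (0 : ℝ)).indicator (fun w => w * Real.exp (-(mu * w))) w =
      Real.exp (-(mu * u)) * (1 / (lam + mu) ^ 2 + u / (lam + mu)) := by
  have hs : 0 < lam + mu := by positivity
  have h1 := integral_pow_mul_exp_neg_mul 1 hs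
  have h0 := integral_pow_mul_exp_neg_mul 0 hs
  rw [← integral_add_right_eq_self _ u]
  have : ∀ w, (Ioi (0 : ℝ)).indicator (fun t => Real.exp (-(lam * t))) (-u + (w + u)) *
        (Ioi (0 : ℝ)).indicator (fun w => w * Real.exp (-(mu * w))) (w + u) =
      (Ioi (0 : ℝ)).indicator (fun w => Real.exp (-(mu * u)) *
        (w ^ 1 * Real.exp (-((lam + mu) * w)) + u * (w ^ 0 * Real.exp (-((lam + mu) * w))))) w := by
    intro w
    rw [show -u + (w + u) = w by ring]
    by_cases hw : 0 < w
    · have huw : 0 < w + u := by positivity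
      simp only [indicator, mem_Ioi, hw, huw, if_true]
      have e1 : Real.exp (-(mu * (w + u))) = Real.exp (-(mu * w)) * Real.exp (-(mu * u)) := by
        rw [← Real.exp_add]; ring_nf
      have e2 : Real.exp (-((lam + mu) * w)) = Real.exp (-(lam * w)) * Real.exp (-(mu * w)) := by
        rw [← Real.exp_add]; ring_nf
      rw [e1, e2]
      ring
    · simp [indicator, hw]
  simp_rw [this]
  rw [integral_indicator measurableSet_Ioi, integral_const_mul,
    integral_add (integrableOn_pow_mul_exp_neg_mul 1 hs)
      ((integrableOn_pow_mul_exp_neg_mul 0 hs).const_mul u), integral_const_mul, h0, h1]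
  simp [div_eq_mul_inv]

/-- The mean of the smoothed estimator as a logistic average. -/
lemma integral_smoothed_estimator {lam mu β : ℝ} (hlam : 0 < lam) (hmu : 0 < mu) (hβ : 0 < β) :
    ∫ t in Ioi (0 : ℝ), ∫ w in Ioi (0 : ℝ),
        (-(2 * β / mu) * w * Real.exp (-(β * (t + w))) /
            (Real.exp (-(β * t)) + Real.exp (-(β * w))) ^ 2) *
          (lam * Real.exp (-(lam * t))) * (mu * Real.exp (-(mu * w))) =
      -(2 * lam) * ∫ v in Ioi (0 : ℝ), logisticDensity v * gapWeight lam mu (v / β) := by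
  set a : ℝ → ℝ := (Ioi (0 : ℝ)).indicator (fun t => Real.exp (-(lam * t))) with ha
  set b : ℝ → ℝ := (Ioi (0 : ℝ)).indicator (fun w => w * Real.exp (-(mu * w))) with hb
  have hai : Integrable a := by
    refine IntegrableOn.integrable_indicator ?_ measurableSet_Ioi
    simpa using integrableOn_pow_mul_exp_neg_mul 0 hlam
  have hbi : Integrable b := by
    refine IntegrableOn.integrable_indicator ?_ measurableSet_Ioi
    simpa using integrableOn_pow_mul_exp_neg_mul 1 hmu
  obtain ⟨hi, he⟩ := integral_integral_comp_sub_mul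
    (φ := fun u => logisticDensity (β * u)) (C := 1)
    (continuous_logisticDensity.comp (by fun_prop))
    (fun u => by
      rw [Real.norm_eq_abs, abs_of_nonneg (logisticDensity_nonneg _)]
      exact logisticDensity_le_one _) hai hbi
  have hlhs : ∫ t in Ioi (0 : ℝ), ∫ w in Ioi (0 : ℝ),
        (-(2 * β / mu) * w * Real.exp (-(β * (t + w))) /
            (Real.exp (-(β * t)) + Real.exp (-(β * w))) ^ 2) *
          (lam * Real.exp (-(lam * t))) * (mu * Real.exp (-(mu * w))) =
      (-(2 * lam) * β) * ∫ t, ∫ w, logisticDensity (β * (t - w)) * (a t * b w) := by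
    rw [← integral_const_mul, ← integral_indicator measurableSet_Ioi]
    congr 1
    ext t
    by_cases ht : t ∈ Ioi (0 : ℝ)
    · rw [indicator_of_mem ht, ← integral_const_mul, ← integral_indicator measurableSet_Ioi]
      congr 1
      ext w
      by_cases hw : w ∈ Ioi (0 : ℝ)
      · rw [indicator_of_mem hw, ha, hb, indicator_of_mem ht, indicator_of_mem hw,
          ← exp_neg_mul_div_sq_eq_logisticDensity]
        field_simp
      · simp [hb, indicator_of_notMem hw]
    · simp [ha, indicator_of_notMem ht]
  rw [hlhs, he, integral_eq_integral_Ioi_add_neg hi, mul_assoc]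
  congr 1
  have hK : ∫ u in Ioi (0 : ℝ), (logisticDensity (β * u) * ∫ w, a (u + w) * b w) +
        logisticDensity (β * -u) * ∫ w, a (-u + w) * b w =
      ∫ u in Ioi (0 : ℝ), (fun v => logisticDensity v * gapWeight lam mu (v / β)) (β * u) := by
    refine setIntegral_congr_fun measurableSet_Ioi fun u hu => ?_
    have hu : (0 : ℝ) < u := hu
    simp only [ha, hb]
    rw [integral_gap_of_nonneg hlam hmu hu.le, integral_gap_neg hlam hmu hu.le, mul_neg,
      logisticDensity_neg, mul_div_cancel_left₀ _ hβ.ne', gapWeight]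
    ring
  rw [hK, integral_comp_mul_left_Ioi (fun v => logisticDensity v * gapWeight lam mu (v / β)) 0 hβ,
    mul_zero, smul_eq_mul, mul_inv_cancel_left₀ hβ.ne']

lemma integrableOn_logisticDensity_mul_gapWeight {lam mu β : ℝ} (hlam : 0 < lam) (hmu : 0 < mu)
    (hβ : 0 < β) :
    IntegrableOn (fun v => logisticDensity v * gapWeight lam mu (v / β)) (Ioi 0) := by
  have hs : 0 < lam + mu := by positivity
  refine Integrable.mono' (((integrableOn_logisticDensity_mul_pow 0).const_mul
    (2 / (lam + mu) ^ 2)).add ((integrableOn_logisticDensity_mul_pow 1).const_mul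
    (1 / (β * (lam + mu))))) ?_ ?_
  · refine (continuous_logisticDensity.mul ?_).aestronglyMeasurable
    unfold gapWeight
    fun_prop
  · filter_upwards [ae_restrict_mem measurableSet_Ioi] with v hv
    have hv : (0 : ℝ) < v := hv
    have h1 : Real.exp (-(lam * (v / β))) ≤ 1 := Real.exp_le_one_iff.2 (by simp; positivity)
    have h2 : Real.exp (-(mu * (v / β))) ≤ 1 := Real.exp_le_one_iff.2 (by simp; positivity)
    have hk := logisticDensity_nonneg v
    have hw0 : 0 ≤ gapWeight lam mu (v / β) := by unfold gapWeight; positivity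
    have hw : gapWeight lam mu (v / β) ≤
        1 / (lam + mu) ^ 2 + 1 * (1 / (lam + mu) ^ 2 + v / β / (lam + mu)) := by
      unfold gapWeight; gcongr
    rw [Real.norm_eq_abs, abs_of_nonneg (mul_nonneg hk hw0)]
    refine (mul_le_mul_of_nonneg_left hw hk).trans_eq ?_
    simp only [Pi.add_apply]
    field_simp
    ring

end SoftminBias

/-- the bias of the softmin-smoothed pathwise one-step gradient
estimator for the busy `M/M/1` queue relative to the true one-step gradient
`-2λ/(λ+μ)²` is `β⁻² · π²λ(μ²−λ²+2μλ)/(6(λ+μ)²) + o(β⁻²)` as `β → ∞`. -/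
theorem smoothed_pathwise_bias (lam mu : ℝ) (hlam : 0 < lam) (hmu : 0 < mu) :
    Tendsto
      (fun β : ℝ =>
        β ^ 2 *
          ((∫ t in Ioi (0 : ℝ), ∫ w in Ioi (0 : ℝ),
              (-(2 * β / mu) * w * Real.exp (-(β * (t + w))) /
                  (Real.exp (-(β * t)) + Real.exp (-(β * w))) ^ 2) *
                (lam * Real.exp (-(lam * t))) * (mu * Real.exp (-(mu * w)))) +
            2 * lam / (lam + mu) ^ 2))
      atTop
      (nhds (π ^ 2 * lam * (mu ^ 2 - lam ^ 2 + 2 * mu * lam) / (6 * (lam + mu) ^ 2))) := by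
  have hs : 0 < lam + mu := by positivity
  set κ := (lam ^ 2 + mu ^ 2) / (2 * (lam + mu) ^ 2) - mu / (lam + mu) with hκ
  set C := (lam ^ 3 + mu ^ 3) / (lam + mu) ^ 2 + mu ^ 2 / (2 * (lam + mu)) with hC
  set M := ∫ v in Ioi (0 : ℝ), logisticDensity v * v ^ 3
  have hlim : Tendsto (fun β : ℝ => 2 * lam * C * M / β) atTop (nhds 0) :=
    tendsto_const_nhds.div_atTop tendsto_id
  rw [tendsto_iff_norm_sub_tendsto_zero]
  refine squeeze_zero' (Eventually.of_forall fun _ => norm_nonneg _) ?_ hlim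
  filter_upwards [eventually_gt_atTop 0] with β hβ
  rw [integral_smoothed_estimator hlam hmu hβ]
  have hI := integrableOn_logisticDensity_mul_gapWeight hlam hmu hβ
  have hI0 := (integrableOn_logisticDensity_mul_pow 0).const_mul (2 / (lam + mu) ^ 2)
  have hI2 := (integrableOn_logisticDensity_mul_pow 2).const_mul (κ / β ^ 2)
  have hI3 := (integrableOn_logisticDensity_mul_pow 3).const_mul (C / β ^ 3)
  have hR : |∫ v in Ioi (0 : ℝ), (logisticDensity v * gapWeight lam mu (v / β) -
        2 / (lam + mu) ^ 2 * (logisticDensity v * v ^ 0)) -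
          κ / β ^ 2 * (logisticDensity v * v ^ 2)| ≤ C / β ^ 3 * M := by
    rw [← integral_const_mul, ← Real.norm_eq_abs]
    refine norm_integral_le_of_norm_le hI3 ?_
    filter_upwards [ae_restrict_mem measurableSet_Ioi] with v hv
    have hv : (0 : ℝ) < v := hv
    have h := mul_le_mul_of_nonneg_left
      (abs_gapWeight_sub_le hlam hmu (div_nonneg hv.le hβ.le)) (logisticDensity_nonneg v)
    rw [← hκ, ← hC] at h
    rw [← abs_of_nonneg (logisticDensity_nonneg v), ← abs_mul,
      abs_of_nonneg (logisticDensity_nonneg v)] at h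
    rw [Real.norm_eq_abs]
    refine (le_of_eq ?_).trans (h.trans_eq (by field_simp))
    congr 1
    ring
  have hI1 : IntegrableOn (fun v => logisticDensity v * gapWeight lam mu (v / β) -
      2 / (lam + mu) ^ 2 * (logisticDensity v * v ^ 0)) (Ioi 0) := hI.sub hI0
  rw [integral_sub hI1 hI2, integral_sub hI hI0, integral_const_mul, integral_const_mul,
    integral_logisticDensity_mul_sq] at hR
  simp only [pow_zero, mul_one, integral_logisticDensity] at hR
  have hid : ∀ J : ℝ, β ^ 2 * (-(2 * lam) * J + 2 * lam / (lam + mu) ^ 2) -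
        π ^ 2 * lam * (mu ^ 2 - lam ^ 2 + 2 * mu * lam) / (6 * (lam + mu) ^ 2) =
      -(2 * lam * β ^ 2) *
        (J - 2 / (lam + mu) ^ 2 * (1 / 2) - κ / β ^ 2 * (π ^ 2 / 6)) := by
    intro J
    rw [hκ]
    field_simp
    ring
  rw [hid, Real.norm_eq_abs, abs_mul, abs_neg, abs_of_pos (by positivity : 0 < 2 * lam * β ^ 2)]
  refine (mul_le_mul_of_nonneg_left hR (by positivity)).trans_eq ?_
  field_simp
end

section
/- Let λ > 0, μ > 0 and let h : (0,∞) → ℝ be bounded and measurable. Then ∫₀^∞ ∫₀^∞ s · h(s − t) · 1{t < s} · λ e^{−λ t} · μ e^{−μ s} dt ds = (λ/(λ+μ)²) · ∫₀^∞ h(x) μ e^{−μ x} dx + (λ/(λ+μ)) · ∫₀^∞ x h(x) μ e^{−μ x} dx. Equivalently, for independent T ~ Exp(λ) and S ~ Exp(μ), E[S · h(S − T) · 1{T < S}] = (λ/(λ+μ)²) E[h(S')] + (λ/(λ+μ)) E[S' h(S')], where S' ~ Exp(μ). -/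
open MeasureTheory Real Filter Set

theorem integral_exp_neg_mul_Ioi_zero {r : ℝ} (hr : 0 < r) :
    ∫ t in Ioi (0 : ℝ), Real.exp (-(r * t)) = 1 / r := by
  have := Real.integral_rpow_mul_exp_neg_mul_Ioi (a := 1) one_pos hr
  simpa using this

theorem integral_mul_exp_neg_mul_Ioi_zero {r : ℝ} (hr : 0 < r) :
    ∫ t in Ioi (0 : ℝ), t * Real.exp (-(r * t)) = 1 / r ^ 2 := by
  have := Real.integral_rpow_mul_exp_neg_mul_Ioi (a := 2) two_pos hr
  norm_num [Real.Gamma_two] at this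
  simpa using this

theorem integrableOn_exp_neg_mul_Ioi_zero {r : ℝ} (hr : 0 < r) :
    IntegrableOn (fun t => Real.exp (-(r * t))) (Ioi (0 : ℝ)) := by
  refine not_imp_comm.1 integral_undef ?_
  rw [integral_exp_neg_mul_Ioi_zero hr]
  positivity

theorem integrableOn_mul_exp_neg_mul_Ioi_zero {r : ℝ} (hr : 0 < r) :
    IntegrableOn (fun t => t * Real.exp (-(r * t))) (Ioi (0 : ℝ)) := by
  refine not_imp_comm.1 integral_undef ?_
  rw [integral_mul_exp_neg_mul_Ioi_zero hr]
  positivity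

/-- A bounded measurable factor preserves integrability on `(0, ∞)`. -/
theorem IntegrableOn.bdd_mul_Ioi_zero {f h : ℝ → ℝ} (hf : IntegrableOn f (Ioi (0 : ℝ)))
    (hmeas : Measurable h) {C : ℝ} (hbdd : ∀ x ∈ Ioi (0 : ℝ), |h x| ≤ C) :
    IntegrableOn (fun x => h x * f x) (Ioi (0 : ℝ)) :=
  Integrable.bdd_mul hf hmeas.aestronglyMeasurable
    ((ae_restrict_iff' measurableSet_Ioi).2 (ae_of_all _ hbdd))

/-- The integral over `ℝ` of a sum of two convolutions of integrable functions. -/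
theorem integral_integral_sub_add_mul {a b c d : ℝ → ℝ} (ha : Integrable a) (hb : Integrable b)
    (hc : Integrable c) (hd : Integrable d) :
    ∫ s, ∫ t, (a t * b (s - t) + c t * d (s - t)) =
      (∫ t, a t) * (∫ x, b x) + (∫ t, c t) * (∫ x, d x) := by
  let L := ContinuousLinearMap.mul ℝ ℝ
  have hab := integral_convolution (μ := volume) (ν := volume) L ha hb
  have hcd := integral_convolution (μ := volume) (ν := volume) L hc hd
  rw [ContinuousLinearMap.mul_apply'] at hab hcd
  rw [← hab, ← hcd, ← integral_add (ha.integrable_convolution L hb)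
    (hc.integrable_convolution L hd)]
  refine integral_congr_ae ?_
  filter_upwards [ha.ae_convolution_exists L hb, hc.ae_convolution_exists L hd] with s h₁ h₂
  exact integral_add h₁ h₂

/-- memoryless-property decomposition on the event `{T < S}`:
for independent `T ~ Exp(λ)`, `S ~ Exp(μ)` and bounded measurable `h`,
`E[S·h(S−T)·1{T<S}] = (λ/(λ+μ)²)·E[h(S')] + (λ/(λ+μ))·E[S'·h(S')]`
with `S' ~ Exp(μ)`. -/
theorem memoryless_first_moment_arrival_first (lam mu : ℝ) (hlam : 0 < lam) (hmu : 0 < mu)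
    (h : ℝ → ℝ) (hmeas : Measurable h) (C : ℝ) (hbdd : ∀ x ∈ Ioi (0 : ℝ), |h x| ≤ C) :
    (∫ s in Ioi (0 : ℝ), ∫ t in Ioi (0 : ℝ),
        s * h (s - t) * (if t < s then (1 : ℝ) else 0) *
          (lam * Real.exp (-(lam * t))) * (mu * Real.exp (-(mu * s)))) =
      lam / (lam + mu) ^ 2 * (∫ x in Ioi (0 : ℝ), h x * (mu * Real.exp (-(mu * x)))) +
        lam / (lam + mu) * (∫ x in Ioi (0 : ℝ), x * h x * (mu * Real.exp (-(mu * x)))) := by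
  have hr : 0 < lam + mu := add_pos hlam hmu
  have ha := (integrableOn_mul_exp_neg_mul_Ioi_zero hr).const_mul lam
  have hc := (integrableOn_exp_neg_mul_Ioi_zero hr).const_mul lam
  have hb := IntegrableOn.bdd_mul_Ioi_zero
    ((integrableOn_exp_neg_mul_Ioi_zero hmu).const_mul mu) hmeas hbdd
  have hd := IntegrableOn.bdd_mul_Ioi_zero
    ((integrableOn_mul_exp_neg_mul_Ioi_zero hmu).const_mul mu) hmeas hbdd
  have key := integral_integral_sub_add_mul (IntegrableOn.integrable_indicator ha measurableSet_Ioi)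
    (hb.integrable_indicator measurableSet_Ioi)
    (IntegrableOn.integrable_indicator hc measurableSet_Ioi)
    (hd.integrable_indicator measurableSet_Ioi)
  simp only [integral_indicator measurableSet_Ioi, integral_const_mul,
    integral_mul_exp_neg_mul_Ioi_zero hr, integral_exp_neg_mul_Ioi_zero hr] at key
  have hd_eq : ∀ x : ℝ, x * h x * (mu * Real.exp (-(mu * x))) =
      h x * (mu * (x * Real.exp (-(mu * x)))) := fun x => by ring
  simp only [hd_eq]
  rw [div_eq_mul_one_div lam ((lam + mu) ^ 2), div_eq_mul_one_div lam (lam + mu), ← key,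
    ← integral_indicator measurableSet_Ioi]
  refine integral_congr_ae (ae_of_all _ fun s => ?_)
  by_cases hs : s ∈ Ioi (0 : ℝ)
  · simp only [indicator_of_mem hs]
    rw [← integral_indicator measurableSet_Ioi]
    refine integral_congr_ae (ae_of_all _ fun t => ?_)
    by_cases ht : t ∈ Ioi (0 : ℝ)
    · by_cases hts : t < s
      · have hx : s - t ∈ Ioi (0 : ℝ) := sub_pos.2 hts
        simp only [indicator_of_mem ht, indicator_of_mem hx, if_pos hts]
        have hexp : Real.exp (-(lam * t)) * Real.exp (-(mu * s)) =
            Real.exp (-((lam + mu) * t)) * Real.exp (-(mu * (s - t))) := by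
          rw [← Real.exp_add, ← Real.exp_add]
          congr 1
          ring
        linear_combination (s * h (s - t) * lam * mu) * hexp
      · simp [hts]
    · simp only [indicator_of_notMem ht, zero_mul, add_zero]
  · rw [indicator_of_notMem hs, eq_comm]
    refine integral_eq_zero_of_ae (ae_of_all _ fun t => ?_)
    by_cases ht : t ∈ Ioi (0 : ℝ)
    · have hx : s - t ∉ Ioi (0 : ℝ) := by
        simp only [mem_Ioi, not_lt] at hs ht ⊢
        linarith
      simp [indicator_of_notMem hx]
    · simp only [indicator_of_notMem ht, zero_mul, add_zero, Pi.zero_apply]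
end
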